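/- arXiv:2402.18869 — 5 statements merged into one kernel-verified Lean document; each statement's English description precedes it below -/
import Mathlib

section
/- Let Λ : ℝ → ℝ be twice continuously differentiable on an open set containing [0,1], with Λ(y) > 0 for all y ∈ [0,1], Λ'(y) ≥ 0 for all y ∈ [0,1], and Λ(y)(Λ'(y) + y·Λ''(y)) − y·Λ'(y)² > 0 for all y ∈ (0,1). Fix δ with 0 < δ < Λ'(1)/Λ(1). Then the function F(y) := y·Λ'(y) − δ·Λ(y) has exactly one zero y* in the interval (0,1); moreover F(y) < 0 for 0 < y < y* and F(y) > 0 for y* < y ≤ 1. (This is Corollary 1 of the paper: the stationarity equation of the dual GV optimization has a unique solution.) -/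
/-- Corollary 1 of the paper: for `0 < δ < Λ'(1)/Λ(1)`, the function
`F(y) = y Λ'(y) − δ Λ(y)` has exactly one zero `y*` in `(0,1)`, is negative before it
and positive after it. -/
theorem F_unique_zero (Λ : ℝ → ℝ) (U : Set ℝ) (hU : IsOpen U)
    (hIcc : Set.Icc (0 : ℝ) 1 ⊆ U) (hC2 : ContDiffOn ℝ 2 Λ U)
    (hpos : ∀ y ∈ Set.Icc (0 : ℝ) 1, 0 < Λ y)
    (hderiv_nonneg : ∀ y ∈ Set.Icc (0 : ℝ) 1, 0 ≤ deriv Λ y)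
    (hconv : ∀ y ∈ Set.Ioo (0 : ℝ) 1,
      0 < Λ y * (deriv Λ y + y * deriv (deriv Λ) y) - y * (deriv Λ y) ^ 2)
    (δ : ℝ) (hδ0 : 0 < δ) (hδ1 : δ < deriv Λ 1 / Λ 1) :
    ∃ ystar ∈ Set.Ioo (0 : ℝ) 1,
      (ystar * deriv Λ ystar - δ * Λ ystar = 0) ∧
      (∀ y ∈ Set.Ioo (0 : ℝ) 1, y * deriv Λ y - δ * Λ y = 0 → y = ystar) ∧
      (∀ y : ℝ, 0 < y → y < ystar → y * deriv Λ y - δ * Λ y < 0) ∧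
      (∀ y : ℝ, ystar < y → y ≤ 1 → 0 < y * deriv Λ y - δ * Λ y) := by
  have hd1 : ∀ y ∈ Set.Icc (0 : ℝ) 1, HasDerivAt Λ (deriv Λ y) y := fun y hy =>
    ((hC2.contDiffAt (hU.mem_nhds (hIcc hy))).differentiableAt (by norm_num)).hasDerivAt
  have hC1 : ContDiffOn ℝ 1 (deriv Λ) U :=
    hC2.deriv_of_isOpen hU (by norm_num)
  have hd2 : ∀ y ∈ Set.Icc (0 : ℝ) 1, HasDerivAt (deriv Λ) (deriv (deriv Λ) y) y := fun y hy =>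
    ((hC1.contDiffAt (hU.mem_nhds (hIcc hy))).differentiableAt (by norm_num)).hasDerivAt
  have hg : ∀ y ∈ Set.Icc (0 : ℝ) 1, HasDerivAt (fun y => y * deriv Λ y / Λ y)
      (((1 * deriv Λ y + y * deriv (deriv Λ) y) * Λ y - y * deriv Λ y * deriv Λ y) / Λ y ^ 2) y :=
    fun y hy => ((hasDerivAt_id y).mul (hd2 y hy)).div (hd1 y hy) (hpos y hy).ne'
  have hcont : ContinuousOn (fun y => y * deriv Λ y / Λ y) (Set.Icc 0 1) :=
    fun y hy => (hg y hy).continuousAt.continuousWithinAt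
  have hmono : StrictMonoOn (fun y => y * deriv Λ y / Λ y) (Set.Icc 0 1) := by
    apply strictMonoOn_of_deriv_pos (convex_Icc 0 1) hcont
    intro y hy
    rw [interior_Icc] at hy
    have hy' := Set.Ioo_subset_Icc_self hy
    rw [(hg y hy').deriv]
    apply div_pos _ (pow_pos (hpos y hy') 2)
    have := hconv y hy
    nlinarith
  have key : ∀ y ∈ Set.Icc (0 : ℝ) 1,
      y * deriv Λ y - δ * Λ y = Λ y * (y * deriv Λ y / Λ y - δ) := by
    intro y hy
    have := (hpos y hy).ne'
    field_simp
  obtain ⟨s, hs, hsδ⟩ := intermediate_value_Ioo (zero_le_one) hcont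
    (show δ ∈ Set.Ioo _ _ from ⟨by simpa using hδ0, by simpa using hδ1⟩)
  have hs' := Set.Ioo_subset_Icc_self hs
  have hlt : ∀ y : ℝ, 0 < y → y < s → y * deriv Λ y - δ * Λ y < 0 := by
    intro y h0 h1
    have hy : y ∈ Set.Icc (0 : ℝ) 1 := ⟨h0.le, (h1.trans hs.2).le⟩
    have h := hmono hy hs' h1
    simp only at h hsδ
    rw [key y hy]
    exact mul_neg_of_pos_of_neg (hpos y hy) (by linarith)
  have hgt : ∀ y : ℝ, s < y → y ≤ 1 → 0 < y * deriv Λ y - δ * Λ y := by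
    intro y h0 h1
    have hy : y ∈ Set.Icc (0 : ℝ) 1 := ⟨(hs.1.trans h0).le, h1⟩
    have h := hmono hs' hy h0
    simp only at h hsδ
    rw [key y hy]
    exact mul_pos (hpos y hy) (by linarith)
  refine ⟨s, hs, ?_, ?_, hlt, hgt⟩
  · simp only at hsδ
    rw [key s hs', hsδ]; simp
  · intro y hy h
    rcases lt_trichotomy y s with h1 | h1 | h1
    · exact absurd h (hlt y hy.1 h1).ne
    · exact h1
    · exact absurd h (hgt y h1 hy.2.le).ne'
end

section
/- Let Λ : ℝ → ℝ be twice continuously differentiable on an open set containing [0,1], with Λ(y) > 0 for all y ∈ [0,1], Λ'(y) ≥ 0 for all y ∈ [0,1], and Λ(y)(Λ'(y) + y·Λ''(y)) − y·Λ'(y)² > 0 for all y ∈ (0,1). Fix y₀ ∈ (0,1] and set δ₀ := y₀·Λ'(y₀)/Λ(y₀). Then for every u ∈ (0,1], −δ₀·log u + log Λ(u) ≥ −δ₀·log y₀ + log Λ(y₀); that is, the infimum defining T̃(δ₀) = inf{ −δ₀ log y + log Λ(y) : 0 < y ≤ 1 } is attained at y = y₀. (This is the core of Theorem 1 of the paper: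 the GV curve can be parametrized by y, since R_GV(δ(y)) = ρ(y).) -/
/-- Core of Theorem 1 of the paper: for `y₀ ∈ (0,1]` and `δ₀ = y₀ Λ'(y₀)/Λ(y₀)`, the
infimum of `−δ₀ log y + log Λ(y)` over `(0,1]` is attained at `y₀`. -/
theorem dual_attained_at_y0 (Λ : ℝ → ℝ) (U : Set ℝ) (hU : IsOpen U)
    (hIcc : Set.Icc (0 : ℝ) 1 ⊆ U) (hC2 : ContDiffOn ℝ 2 Λ U)
    (hpos : ∀ y ∈ Set.Icc (0 : ℝ) 1, 0 < Λ y)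
    (hderiv_nonneg : ∀ y ∈ Set.Icc (0 : ℝ) 1, 0 ≤ deriv Λ y)
    (hconv : ∀ y ∈ Set.Ioo (0 : ℝ) 1,
      0 < Λ y * (deriv Λ y + y * deriv (deriv Λ) y) - y * (deriv Λ y) ^ 2)
    (y₀ : ℝ) (hy₀ : y₀ ∈ Set.Ioc (0 : ℝ) 1) :
    ∀ u ∈ Set.Ioc (0 : ℝ) 1,
      -(y₀ * deriv Λ y₀ / Λ y₀) * Real.log y₀ + Real.log (Λ y₀) ≤
        -(y₀ * deriv Λ y₀ / Λ y₀) * Real.log u + Real.log (Λ u) := by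
  have hd : ∀ y ∈ Set.Icc (0 : ℝ) 1, HasDerivAt Λ (deriv Λ y) y := fun y hy =>
    ((hC2.contDiffAt (hU.mem_nhds (hIcc hy))).differentiableAt (by norm_num)).hasDerivAt
  have hdd : ∀ y ∈ Set.Icc (0 : ℝ) 1, HasDerivAt (deriv Λ) (deriv (deriv Λ) y) y := by
    intro y hy
    have h1 : ContDiffOn ℝ 1 (deriv Λ) U :=
      ((contDiffOn_succ_iff_deriv_of_isOpen (n := 1) hU).1 (by simpa [one_add_one_eq_two] using hC2)).2.2
    exact ((h1.contDiffAt (hU.mem_nhds (hIcc hy))).differentiableAt (by norm_num)).hasDerivAt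
  have hD : ∀ y ∈ Set.Icc (0 : ℝ) 1, HasDerivAt (fun y => y * deriv Λ y / Λ y)
      (((1 * deriv Λ y + y * deriv (deriv Λ) y) * Λ y - y * deriv Λ y * deriv Λ y) / Λ y ^ 2) y :=
    fun y hy => ((hasDerivAt_id y).mul (hdd y hy)).div (hd y hy) (hpos y hy).ne'
  have hmono : MonotoneOn (fun y => y * deriv Λ y / Λ y) (Set.Icc (0 : ℝ) 1) := by
    apply monotoneOn_of_deriv_nonneg (convex_Icc 0 1)
    · exact fun y hy => (hD y hy).continuousAt.continuousWithinAt
    · exact fun y hy => (hD y (interior_subset hy)).differentiableAt.differentiableWithinAt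
    · intro y hy
      rw [(hD y (interior_subset hy)).deriv]
      rw [interior_Icc] at hy
      have := hconv y hy
      apply div_nonneg _ (sq_nonneg _)
      nlinarith
  intro u hu
  set δ := y₀ * deriv Λ y₀ / Λ y₀ with hδ
  have hf : ∀ y ∈ Set.Ioc (0 : ℝ) 1, HasDerivAt (fun y => -δ * Real.log y + Real.log (Λ y))
      (-δ * y⁻¹ + deriv Λ y / Λ y) y := fun y hy =>
    ((Real.hasDerivAt_log hy.1.ne').const_mul _).add
      ((hd y ⟨hy.1.le, hy.2⟩).log (hpos y ⟨hy.1.le, hy.2⟩).ne')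
  have heq : ∀ y ∈ Set.Ioc (0 : ℝ) 1,
      -δ * y⁻¹ + deriv Λ y / Λ y = (y * deriv Λ y / Λ y - δ) / y := by
    intro y hy
    have h1 := hy.1.ne'
    have h2 := (hpos y ⟨hy.1.le, hy.2⟩).ne'
    field_simp
    ring
  rcases le_total y₀ u with h | h
  · have hs : ∀ y ∈ Set.Icc y₀ u, y ∈ Set.Ioc (0 : ℝ) 1 := fun y hy =>
      ⟨hy₀.1.trans_le hy.1, hy.2.trans hu.2⟩
    refine monotoneOn_of_deriv_nonneg (f := fun y => -δ * Real.log y + Real.log (Λ y))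
      (convex_Icc y₀ u) ?_ ?_ ?_ ⟨le_rfl, h⟩ ⟨h, le_rfl⟩ h
    · exact fun y hy => (hf y (hs y hy)).continuousAt.continuousWithinAt
    · exact fun y hy => (hf y (hs y (interior_subset hy))).differentiableAt.differentiableWithinAt
    · intro y hy
      have hy := interior_subset hy
      have hy1 := hs y hy
      rw [(hf y hy1).deriv, heq y hy1]
      exact div_nonneg (sub_nonneg.2 (hmono ⟨hy₀.1.le, hy₀.2⟩ ⟨hy1.1.le, hy1.2⟩ hy.1)) hy1.1.le
  · have hs : ∀ y ∈ Set.Icc u y₀, y ∈ Set.Ioc (0 : ℝ) 1 := fun y hy =>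
      ⟨hu.1.trans_le hy.1, hy.2.trans hy₀.2⟩
    refine antitoneOn_of_deriv_nonpos (f := fun y => -δ * Real.log y + Real.log (Λ y))
      (convex_Icc u y₀) ?_ ?_ ?_ ⟨le_rfl, h⟩ ⟨h, le_rfl⟩ h
    · exact fun y hy => (hf y (hs y hy)).continuousAt.continuousWithinAt
    · exact fun y hy => (hf y (hs y (interior_subset hy))).differentiableAt.differentiableWithinAt
    · intro y hy
      have hy := interior_subset hy
      have hy1 := hs y hy
      rw [(hf y hy1).deriv, heq y hy1]
      exact div_nonpos_of_nonpos_of_nonneg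
        (sub_nonpos.2 (hmono ⟨hy1.1.le, hy1.2⟩ ⟨hy₀.1.le, hy₀.2⟩ hy.2)) hy1.1.le
end

section
/- Let Λ : ℝ → ℝ be twice continuously differentiable on an open set containing [0,1], with Λ(y) > 0 for all y ∈ [0,1], Λ'(y) ≥ 0 for all y ∈ [0,1], and Λ(y)(Λ'(y) + y·Λ''(y)) − y·Λ'(y)² > 0 for all y ∈ (0,1). Set δ_max := Λ'(1)/Λ(1). Then for every δ ≥ δ_max and every u ∈ (0,1], −δ·log u + log Λ(u) ≥ log Λ(1); that is, the infimum inf{−δ log y + log Λ(y) : 0 < y ≤ 1} equals log Λ(1) and is attained at y = 1. (This is the part of Theorem 1/Lemma 2 of the paper asserting that R_GV(δ) = 0 for δ ≥ δ_max, since T̃(δ) = log Λ(1;B) = 2Cap(S) there.) -/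
/-- For `δ ≥ δ_max = Λ'(1)/Λ(1)`, the infimum of `−δ log y + log Λ(y)` over `(0,1]`
equals `log Λ(1)` and is attained at `y = 1`. -/
theorem dual_attained_at_one (Λ : ℝ → ℝ) (U : Set ℝ) (hU : IsOpen U)
    (hIcc : Set.Icc (0 : ℝ) 1 ⊆ U) (hC2 : ContDiffOn ℝ 2 Λ U)
    (hpos : ∀ y ∈ Set.Icc (0 : ℝ) 1, 0 < Λ y)
    (hderiv_nonneg : ∀ y ∈ Set.Icc (0 : ℝ) 1, 0 ≤ deriv Λ y)
    (hconv : ∀ y ∈ Set.Ioo (0 : ℝ) 1,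
      0 < Λ y * (deriv Λ y + y * deriv (deriv Λ) y) - y * (deriv Λ y) ^ 2)
    (δ : ℝ) (hδ : deriv Λ 1 / Λ 1 ≤ δ) :
    ∀ u ∈ Set.Ioc (0 : ℝ) 1, Real.log (Λ 1) ≤ -δ * Real.log u + Real.log (Λ u) := by
  have hd1 : ContDiffOn ℝ 1 (deriv Λ) U := by
    have h2 : ContDiffOn ℝ (1 + 1) Λ U := by
      have : (1 + 1 : WithTop ℕ∞) = 2 := by norm_num
      rw [this]; exact hC2
    exact ((contDiffOn_succ_iff_deriv_of_isOpen hU).1 h2).2.2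
  have hD : ∀ y ∈ Set.Icc (0 : ℝ) 1, HasDerivAt Λ (deriv Λ y) y := fun y hy =>
    ((hC2.differentiableOn (by norm_num)).differentiableAt
      (hU.mem_nhds (hIcc hy))).hasDerivAt
  have hDD : ∀ y ∈ Set.Icc (0 : ℝ) 1, HasDerivAt (deriv Λ) (deriv (deriv Λ) y) y := fun y hy =>
    ((hd1.differentiableOn (by norm_num)).differentiableAt
      (hU.mem_nhds (hIcc hy))).hasDerivAt
  have hg : ∀ y ∈ Set.Icc (0 : ℝ) 1, HasDerivAt (fun y => y * deriv Λ y / Λ y)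
      (((1 * deriv Λ y + y * deriv (deriv Λ) y) * Λ y - y * deriv Λ y * deriv Λ y) / Λ y ^ 2)
      y := fun y hy =>
    ((hasDerivAt_id' y).mul (hDD y hy)).div (hD y hy) (hpos y hy).ne'
  have hmono : MonotoneOn (fun y => y * deriv Λ y / Λ y) (Set.Icc (0 : ℝ) 1) := by
    apply monotoneOn_of_deriv_nonneg (convex_Icc 0 1)
    · exact fun y hy => (hg y hy).continuousAt.continuousWithinAt
    · intro y hy
      rw [interior_Icc] at hy
      exact (hg y (Set.Ioo_subset_Icc_self hy)).differentiableAt.differentiableWithinAt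
    · intro y hy
      rw [interior_Icc] at hy
      rw [(hg y (Set.Ioo_subset_Icc_self hy)).deriv]
      apply div_nonneg _ (sq_nonneg _)
      nlinarith [hconv y hy]
  intro u hu
  have hsub : ∀ y ∈ Set.Icc u 1, y ∈ Set.Icc (0 : ℝ) 1 := fun y hy =>
    ⟨hu.1.le.trans hy.1, hy.2⟩
  have hf : ∀ y ∈ Set.Icc u 1, HasDerivAt (fun y => -δ * Real.log y + Real.log (Λ y))
      (-δ * y⁻¹ + deriv Λ y / Λ y) y := fun y hy =>
    ((Real.hasDerivAt_log (hu.1.trans_le hy.1).ne').const_mul (-δ)).add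
      ((hD y (hsub y hy)).log (hpos y (hsub y hy)).ne')
  have hanti : AntitoneOn (fun y => -δ * Real.log y + Real.log (Λ y)) (Set.Icc u 1) := by
    apply antitoneOn_of_deriv_nonpos (convex_Icc u 1)
    · exact fun y hy => (hf y hy).continuousAt.continuousWithinAt
    · intro y hy
      rw [interior_Icc] at hy
      exact (hf y (Set.Ioo_subset_Icc_self hy)).differentiableAt.differentiableWithinAt
    · intro y hy
      rw [interior_Icc] at hy
      have hy' := Set.Ioo_subset_Icc_self hy
      rw [(hf y hy').deriv]
      have hy0 : 0 < y := hu.1.trans hy.1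
      have h1 := hmono (hsub y hy') (Set.right_mem_Icc.2 zero_le_one) hy'.2
      simp only [one_mul] at h1
      have h2 : -δ * y⁻¹ + deriv Λ y / Λ y = (y * deriv Λ y / Λ y - δ) * y⁻¹ := by
        field_simp
        ring
      rw [h2]
      exact mul_nonpos_of_nonpos_of_nonneg (by linarith) (inv_nonneg.2 hy0.le)
  have := hanti (Set.left_mem_Icc.2 hu.2) (Set.right_mem_Icc.2 hu.2) hu.2
  simpa using this
end

section
/- Let f : ℝ → ℝ and g : ℝ → ℝ → ℝ be twice continuously differentiable, let δ ∈ ℝ, and let (p*, x*, y*, z*) be a point with x*, y*, z* > 0, f(z*) > 0 and g(x*, y*) > 0 satisfying the constraints G₁ := z*·f'(z*) − p*·f(z*) = 0, G₂ := x*·g_x(x*,y*) − 2p*·g(x*,y*) = 0, and G₃ := y*·g_y(x*,y*) − δ·g(x*,y*) = 0. Suppose there exist real numbers λ₁, λ₂, λ₃ such that all four partial derivatives (in p, x, y, z) of the Lagrangian L(p,x,y,z) := −2p·log z + 2·log f(z) + 2p·log x + δ·log y − log g(x,y) + λ₁(z f'(z) − p f(z)) + λ₂(x g_x(x,y) − 2p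 g(x,y)) + λ₃(y g_y(x,y) − δ g(x,y)) vanish at (p*, x*, y*, z*). Assume the nondegeneracy conditions: f'(z*) + z*·f''(z*) − p*·f'(z*) ≠ 0, and the 2×2 matrix of partial derivatives of (G₂, G₃) with respect to (x, y) at (x*, y*) is invertible. Then λ₁ = λ₂ = λ₃ = 0 and x* = z*. (This is Theorem 2 of the paper, where f(z) = Λ(z;C) and g(x,y) = Λ(x,y;D) are the dominant eigenvalue functions; the theorem reduces the GV–MR optimization to solving G₁ = G₂ = G₃ = 0 with x = z.) -/
/-- Theorem 2 of the paper (Lagrangian analysis of the GV–MR optimization):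
at a stationary point of the Lagrangian satisfying the constraints and nondegeneracy,
all multipliers vanish and `x* = z*`. -/
theorem lagrange_multipliers_vanish
    (f : ℝ → ℝ) (g : ℝ → ℝ → ℝ)
    (hf : ContDiff ℝ 2 f) (hg : ContDiff ℝ 2 (Function.uncurry g))
    (δ ps xs ys zs : ℝ)
    (hxs : 0 < xs) (hys : 0 < ys) (hzs : 0 < zs)
    (hfz : 0 < f zs) (hgxy : 0 < g xs ys)
    -- partial-derivative abbreviations
    (gx : ℝ → ℝ → ℝ) (gy : ℝ → ℝ → ℝ)
    (hgx : ∀ x y, gx x y = deriv (fun x' => g x' y) x)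
    (hgy : ∀ x y, gy x y = deriv (fun y' => g x y') y)
    -- the constraints G₁ = G₂ = G₃ = 0 at the point
    (hG1 : zs * deriv f zs - ps * f zs = 0)
    (hG2 : xs * gx xs ys - 2 * ps * g xs ys = 0)
    (hG3 : ys * gy xs ys - δ * g xs ys = 0)
    -- the Lagrangian and its stationarity
    (l1 l2 l3 : ℝ) (L : ℝ → ℝ → ℝ → ℝ → ℝ)
    (hL : ∀ p x y z, L p x y z =
      -2 * p * Real.log z + 2 * Real.log (f z) + 2 * p * Real.log x +
        δ * Real.log y - Real.log (g x y) +
        l1 * (z * deriv f z - p * f z) +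
        l2 * (x * gx x y - 2 * p * g x y) +
        l3 * (y * gy x y - δ * g x y))
    (hLp : deriv (fun p => L p xs ys zs) ps = 0)
    (hLx : deriv (fun x => L ps x ys zs) xs = 0)
    (hLy : deriv (fun y => L ps xs y zs) ys = 0)
    (hLz : deriv (fun z => L ps xs ys z) zs = 0)
    -- nondegeneracy conditions
    (hnd1 : deriv f zs + zs * deriv (deriv f) zs - ps * deriv f zs ≠ 0)
    (hnd2 :
      deriv (fun x => x * gx x ys - 2 * ps * g x ys) xs *
          deriv (fun y => y * gy xs y - δ * g xs y) ys -
        deriv (fun y => xs * gx xs y - 2 * ps * g xs y) ys *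
          deriv (fun x => ys * gy x ys - δ * g x ys) xs ≠ 0) :
    l1 = 0 ∧ l2 = 0 ∧ l3 = 0 ∧ xs = zs := by
  have hgd : Differentiable ℝ (Function.uncurry g) := hg.differentiable (by norm_num)
  have hfd : Differentiable ℝ f := hf.differentiable (by norm_num)
  have hF : ContDiff ℝ 1 (fderiv ℝ (Function.uncurry g)) :=
    hg.fderiv_right (by norm_num)
  have hFd : Differentiable ℝ (fderiv ℝ (Function.uncurry g)) :=
    hF.differentiable (by norm_num)
  have hf' : Differentiable ℝ (deriv f) := by
    have h : ContDiff ℝ (1 + 1) f := by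
      convert hf using 1
      norm_num
    exact ((contDiff_succ_iff_deriv.1 h).2.2).differentiable (by norm_num)
  have hpx : ∀ x y : ℝ, HasDerivAt (fun x' : ℝ => (x', y)) ((1 : ℝ), (0 : ℝ)) x :=
    fun x y => (hasDerivAt_id x).prodMk (hasDerivAt_const x y)
  have hpy : ∀ x y : ℝ, HasDerivAt (fun y' : ℝ => (x, y')) ((0 : ℝ), (1 : ℝ)) y :=
    fun x y => (hasDerivAt_const y x).prodMk (hasDerivAt_id y)
  have hgX : ∀ x y, HasDerivAt (fun x' => g x' y)
      (fderiv ℝ (Function.uncurry g) (x, y) (1, 0)) x := fun x y =>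
    HasFDerivAt.comp_hasDerivAt (l := Function.uncurry g) x (hgd (x, y)).hasFDerivAt (hpx x y)
  have hgY : ∀ x y, HasDerivAt (fun y' => g x y')
      (fderiv ℝ (Function.uncurry g) (x, y) (0, 1)) y := fun x y =>
    HasFDerivAt.comp_hasDerivAt (l := Function.uncurry g) y (hgd (x, y)).hasFDerivAt (hpy x y)
  have egx : gx = fun x y => fderiv ℝ (Function.uncurry g) (x, y) (1, 0) := by
    funext x y
    rw [hgx, (hgX x y).deriv]
  have egy : gy = fun x y => fderiv ℝ (Function.uncurry g) (x, y) (0, 1) := by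
    funext x y
    rw [hgy, (hgY x y).deriv]
  have dgx1 : Differentiable ℝ (fun x => gx x ys) := by
    rw [egx]
    fun_prop
  have dgx2 : Differentiable ℝ (fun y => gx xs y) := by
    rw [egx]
    fun_prop
  have dgy1 : Differentiable ℝ (fun x => gy x ys) := by
    rw [egy]
    fun_prop
  have dgy2 : Differentiable ℝ (fun y => gy xs y) := by
    rw [egy]
    fun_prop
  have hgx0 : HasDerivAt (fun x => g x ys) (gx xs ys) xs := by
    rw [egx]
    exact hgX xs ys
  have hgy0 : HasDerivAt (fun y => g xs y) (gy xs ys) ys := by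
    rw [egy]
    exact hgY xs ys
  have dg1 : Differentiable ℝ (fun x => g x ys) := fun x => (hgX x ys).differentiableAt
  have dg2 : Differentiable ℝ (fun y => g xs y) := fun y => (hgY xs y).differentiableAt
  have hA : DifferentiableAt ℝ (fun x => x * gx x ys - 2 * ps * g x ys) xs := by fun_prop
  have hB : DifferentiableAt ℝ (fun y => xs * gx xs y - 2 * ps * g xs y) ys := by fun_prop
  have hC : DifferentiableAt ℝ (fun x => ys * gy x ys - δ * g x ys) xs := by fun_prop
  have hD : DifferentiableAt ℝ (fun y => y * gy xs y - δ * g xs y) ys := by fun_prop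
  replace hA := hA.hasDerivAt
  replace hB := hB.hasDerivAt
  replace hC := hC.hasDerivAt
  replace hD := hD.hasDerivAt
  generalize deriv (fun x => x * gx x ys - 2 * ps * g x ys) xs = A at *
  generalize deriv (fun y => xs * gx xs y - 2 * ps * g xs y) ys = B at *
  generalize deriv (fun x => ys * gy x ys - δ * g x ys) xs = C at *
  generalize deriv (fun y => y * gy xs y - δ * g xs y) ys = D at *
  simp only [hL] at hLp hLx hLy hLz
  have ex := ((((((((Real.hasDerivAt_log hxs.ne').const_mul (2 * ps)).const_add
    (-2 * ps * Real.log zs + 2 * Real.log (f zs))).add_const (δ * Real.log ys)).sub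
    (hgx0.log hgxy.ne')).add_const (l1 * (zs * deriv f zs - ps * f zs))).add
    (hA.const_mul l2)).add (hC.const_mul l3)).deriv
  have ey := (((((((Real.hasDerivAt_log hys.ne').const_mul δ).const_add
    (-2 * ps * Real.log zs + 2 * Real.log (f zs) + 2 * ps * Real.log xs)).sub
    (hgy0.log hgxy.ne')).add_const (l1 * (zs * deriv f zs - ps * f zs))).add
    (hB.const_mul l2)).add (hD.const_mul l3)).deriv
  have hE := ((hasDerivAt_id zs).mul (hf' zs).hasDerivAt).sub
    ((hfd zs).hasDerivAt.const_mul ps)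
  have ez := (((((((((Real.hasDerivAt_log hzs.ne').const_mul (-2 * ps)).add
    (((hfd zs).hasDerivAt.log hfz.ne').const_mul 2)).add_const
    (2 * ps * Real.log xs)).add_const (δ * Real.log ys)).sub_const
    (Real.log (g xs ys))).add (hE.const_mul l1)).add_const
    (l2 * (xs * gx xs ys - 2 * ps * g xs ys))).add_const
    (l3 * (ys * gy xs ys - δ * g xs ys))).deriv
  have ex' := ex.symm.trans hLx
  have ey' := ey.symm.trans hLy
  have ez' := ez.symm.trans hLz
  simp only [id] at ez'
  have c1 : 2 * ps * xs⁻¹ - gx xs ys / g xs ys = 0 := by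
    field_simp
    linarith
  have c2 : δ * ys⁻¹ - gy xs ys / g xs ys = 0 := by
    field_simp
    linarith
  have c3 : -2 * ps * zs⁻¹ + 2 * (deriv f zs / f zs) = 0 := by
    field_simp
    linarith
  have h1 : l1 = 0 := by
    have : l1 * (deriv f zs + zs * deriv (deriv f) zs - ps * deriv f zs) = 0 := by
      linarith
    exact (mul_eq_zero.1 this).resolve_right hnd1
  have q1 : l2 * A + l3 * C = 0 := by linarith
  have q2 : l2 * B + l3 * D = 0 := by linarith
  have h2 : l2 = 0 := by
    have : l2 * (A * D - B * C) = 0 := by linear_combination D * q1 - C * q2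
    exact (mul_eq_zero.1 this).resolve_right hnd2
  have h3 : l3 = 0 := by
    have : l3 * (A * D - B * C) = 0 := by linear_combination A * q2 - B * q1
    exact (mul_eq_zero.1 this).resolve_right hnd2
  refine ⟨h1, h2, h3, ?_⟩
  subst h1 h2 h3
  have ep : HasDerivAt (fun p : ℝ => (2 * Real.log xs - 2 * Real.log zs) * p +
      (2 * Real.log (f zs) + δ * Real.log ys - Real.log (g xs ys)))
      ((2 * Real.log xs - 2 * Real.log zs) * 1) ps :=
    ((hasDerivAt_id ps).const_mul _).add_const _
  have ep' := ep.deriv.symm.trans (Eq.trans (by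
    congr 1
    funext p
    ring) hLp)
  exact Real.log_injOn_pos hxs hzs (by linarith)
end

section
/- Let n ≥ 1 and let A : ℝ → (n×n real matrices) be a matrix family whose entries are differentiable at z₀. Suppose that on a neighborhood of z₀ there are differentiable functions λ_i : ℝ → ℝ and e_i : ℝ → ℝⁿ (i = 1,…,n) such that for each z the vectors e₁(z), …, e_n(z) form an orthonormal basis of ℝⁿ, A(z)·e_i(z) = λ_i(z)·e_i(z), λ₁(z) > 0 and λ₁(z) > |λ_i(z)| for i ≥ 2. Let q⁽⁰⁾ : ℝ → ℝⁿ be differentiable at z₀ with q⁽⁰⁾(z) = Σ_i α_i(z)·e_i(z), each α_i differentiable at z₀, ‖q⁽⁰⁾(z₀)‖ = 1 and α₁(z₀) ≠ 0. At z = z₀, write A := A(z₀) and let A' be the entrywise derivative of the family at z₀; set r⁽⁰⁾ := (q⁽⁰⁾)'(z₀), and define recursively for k ≥ 1: λ⁽ᵏ⁾ := ‖A·q⁽ᵏ⁻¹⁾‖, q⁽ᵏ⁾ := A·q⁽ᵏ⁻¹⁾/λ⁽ᵏ⁾, μ⁽ᵏ⁾ := ‖A'·q⁽ᵏ⁻¹⁾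 + A·r⁽ᵏ⁻¹⁾ − λ⁽ᵏ⁾·r⁽ᵏ⁻¹⁾‖, r⁽ᵏ⁾ := (A·r⁽ᵏ⁻¹⁾ + A'·q⁽ᵏ⁻¹⁾ − μ⁽ᵏ⁾·q⁽ᵏ⁻¹⁾)/λ⁽ᵏ⁾. If λ₁'(z₀) ≥ 0, then μ⁽ᵏ⁾ → λ₁'(z₀) as k → ∞. (This is the derivative-convergence part of Theorem 4 (Power Iteration I) of the paper: the modified power iteration computes the derivative of the dominant eigenvalue.) -/
section PIaux
open Filter Topology

lemma pi_geo (u : ℕ → ℝ) (ρ G : ℝ) (h0 : 0 ≤ ρ) (h1 : ρ < 1) (hG : 0 ≤ G) (N : ℕ)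
    (hu : ∀ k, N ≤ k → u (k+1) ≤ ρ * u k + G) (k : ℕ) :
    u (N + k) ≤ ρ ^ k * u N + G / (1 - ρ) := by
  have hp : 0 < 1 - ρ := by linarith
  induction k with
  | zero => simp; positivity
  | succ k ih =>
    have h := hu (N + k) (by omega)
    have h2 := mul_le_mul_of_nonneg_left ih h0
    have h3 : ρ * (G / (1 - ρ)) + G = G / (1 - ρ) := by field_simp; ring
    rw [← add_assoc, pow_succ]
    nlinarith

lemma pi_bdd (u : ℕ → ℝ) (hu0 : ∀ k, 0 ≤ u k) (ρ G : ℝ) (h0 : 0 ≤ ρ) (h1 : ρ < 1) (hG : 0 ≤ G)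
    (hu : ∀ᶠ k in atTop, u (k+1) ≤ ρ * u k + G) : ∃ C, 0 ≤ C ∧ ∀ᶠ k in atTop, u k ≤ C := by
  obtain ⟨N, hN⟩ := eventually_atTop.1 hu
  have hp : 0 < 1 - ρ := by linarith
  refine ⟨u N + G / (1 - ρ), by have := hu0 N; positivity, ?_⟩
  filter_upwards [eventually_ge_atTop N] with k hk
  obtain ⟨j, rfl⟩ := Nat.exists_eq_add_of_le hk
  have := pi_geo u ρ G h0 h1 hG N hN j
  have h2 : ρ ^ j * u N ≤ u N := mul_le_of_le_one_left (hu0 N) (pow_le_one₀ h0 h1.le)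
  linarith

lemma pi_zero (u g : ℕ → ℝ) (hu0 : ∀ k, 0 ≤ u k) (ρ : ℝ) (h0 : 0 ≤ ρ) (h1 : ρ < 1)
    (hg : Tendsto g atTop (𝓝 0))
    (hu : ∀ᶠ k in atTop, u (k+1) ≤ ρ * u k + g k) : Tendsto u atTop (𝓝 0) := by
  have hp : 0 < 1 - ρ := by linarith
  rw [Metric.tendsto_atTop]
  intro ε hε
  have hgE : ∀ᶠ k in atTop, g k < (ε/2) * (1-ρ) := hg.eventually (gt_mem_nhds (by positivity))
  obtain ⟨N, hN⟩ := eventually_atTop.1 (hu.and hgE)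
  have hpow : Tendsto (fun k => ρ ^ k * u N) atTop (𝓝 0) := by
    simpa using (tendsto_pow_atTop_nhds_zero_of_lt_one h0 h1).mul_const (u N)
  obtain ⟨M, hM⟩ := eventually_atTop.1 (hpow.eventually (gt_mem_nhds (half_pos hε)))
  refine ⟨N + M, fun k hk => ?_⟩
  obtain ⟨j, rfl⟩ := Nat.exists_eq_add_of_le (show N ≤ k by omega)
  have := pi_geo u ρ ((ε/2) * (1-ρ)) h0 h1 (by positivity) N
    (fun k hk => by have := hN k hk; linarith) j
  rw [mul_div_cancel_right₀ _ hp.ne'] at this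
  have h3 := hM j (by omega)
  rw [Real.dist_eq, sub_zero, abs_of_nonneg (hu0 _)]
  linarith

lemma pi_lim (x p g : ℕ → ℝ) (P G : ℝ) (hP : |P| < 1) (hp : Tendsto p atTop (𝓝 P))
    (hg : Tendsto g atTop (𝓝 G)) (hx : ∀ k, x (k+1) = p k * x k + g k) :
    Tendsto x atTop (𝓝 (G / (1 - P))) := by
  have hP1 : 1 - P ≠ 0 := by have := (abs_lt.1 hP).2; linarith
  set X := G / (1 - P) with hX
  have hfix : P * X + G = X := by rw [hX]; field_simp; ring
  obtain ⟨ρ, hρ1, hρ2⟩ := exists_between hP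
  have key : Tendsto (fun k => |x k - X|) atTop (𝓝 0) := by
    refine pi_zero _ (fun k => |(p k - P) * X + (g k - G)|) (fun k => abs_nonneg _) ρ
      ((abs_nonneg _).trans hρ1.le) hρ2 ?_ ?_
    · have : Tendsto (fun k => |(p k - P) * X + (g k - G)|) atTop (𝓝 |(P - P) * X + (G - G)|) :=
        (((hp.sub_const P).mul_const X).add (hg.sub_const G)).abs
      simpa using this
    · filter_upwards [hp.abs.eventually (gt_mem_nhds hρ1)] with k hk
      have : x (k+1) - X = p k * (x k - X) + ((p k - P) * X + (g k - G)) := by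
        rw [hx]; linear_combination hfix
      rw [this]
      refine (abs_add_le _ _).trans ?_
      rw [abs_mul]
      gcongr
  have := (tendsto_zero_iff_abs_tendsto_zero _).2 key
  simpa using this.add_const X

lemma pi_core {ι : Type*} [Fintype ι] [DecidableEq ι] (o : ι) (l : ι → ℝ)
    (β c b : ι → ℕ → ℝ) (binf : ι → ℝ) (lam mu : ℕ → ℝ) (t : ℝ) (ht0 : 0 < t) (ht1 : t < 1)
    (hL : 0 < l o) (hlt : ∀ i, i ≠ o → |l i| < t * l o)
    (hlam : Tendsto lam atTop (𝓝 (l o)))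
    (hlam' : Tendsto (fun k => (l o - lam k) / t ^ k) atTop (𝓝 0))
    (hβ : ∀ i, i ≠ o → Tendsto (β i) atTop (𝓝 0)) (hβo : ∀ k, |β o k| ≤ 1)
    (hb : ∀ i, Tendsto (b i) atTop (𝓝 (binf i)))
    (hmu0 : ∀ k, 0 ≤ mu k)
    (hmu : ∀ k, mu k ≤ ∑ i, |b i k + (l i - lam k) * c i k|)
    (hc : ∀ i k, c i (k+1) = (lam k)⁻¹ * (l i * c i k + b i k - mu k * β i k)) :
    (∀ i, i ≠ o → Tendsto (fun k => b i k + (l i - lam k) * c i k) atTop (𝓝 0)) ∧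
    Tendsto (fun k => (l o - lam k) * c o k) atTop (𝓝 0) := by
  set s : Finset ι := Finset.univ.erase o with hs
  have hsplit : ∀ f : ι → ℝ, ∑ i, f i = f o + ∑ i ∈ s, f i := fun f =>
    (Finset.add_sum_erase _ f (Finset.mem_univ o)).symm
  have hne : ∀ i ∈ s, i ≠ o := fun i hi => Finset.ne_of_mem_erase hi
  set L := l o with hLdef
  set X : ℕ → ℝ := fun k => ∑ i ∈ s, |c i k| with hX
  set S : ℕ → ℝ := fun k => X k + t ^ k * |c o k| with hSdef
  have hX0 : ∀ k, 0 ≤ X k := fun k => Finset.sum_nonneg fun _ _ => abs_nonneg _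
  have hS0 : ∀ k, 0 ≤ S k := fun k => by have := hX0 k; simp only [hSdef]; positivity
  set D : ℕ → ℝ := fun k => ∑ i ∈ s, |β i k| with hD
  have hD0 : ∀ k, 0 ≤ D k := fun k => Finset.sum_nonneg fun _ _ => abs_nonneg _
  have hDlim : Tendsto D atTop (𝓝 0) := by
    have : Tendsto D atTop (𝓝 (∑ i ∈ s, |(0:ℝ)|)) :=
      tendsto_finsetSum _ fun i hi => (hβ i (hne i hi)).abs
    simpa using this
  have hBlim : Tendsto (fun k => ∑ i, |b i k|) atTop (𝓝 (∑ i, |binf i|)) :=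
    tendsto_finsetSum _ fun i hi => (hb i).abs
  set C0 : ℝ := ∑ i, |binf i| + 1 with hC0
  have hC00 : 0 ≤ C0 := by have : 0 ≤ ∑ i, |binf i| := Finset.sum_nonneg fun _ _ => abs_nonneg _
                           linarith
  have hB : ∀ᶠ k in atTop, ∑ i, |b i k| ≤ C0 := by
    filter_upwards [hBlim.eventually (gt_mem_nhds (lt_add_one _))] with k hk using hk.le
  have hlam2 : ∀ᶠ k in atTop, L / 2 < lam k := hlam.eventually (lt_mem_nhds (by linarith))
  have hlam3 : ∀ᶠ k in atTop, lam k < 2 * L := hlam.eventually (gt_mem_nhds (by linarith))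
  have hlamt : ∀ i ∈ s, ∀ᶠ k in atTop, |l i| < t * lam k := fun i hi =>
    (hlam.const_mul t).eventually (lt_mem_nhds (hlt i (hne i hi)))
  have hlamt' : ∀ᶠ k in atTop, ∀ i ∈ s, |l i| < t * lam k :=
    (Filter.eventually_all_finset s).2 hlamt
  set K : ℝ := 3 * L + 1 with hK
  have hw : ∀ᶠ k in atTop, |(L - lam k) / t ^ k| < K := by
    have := hlam'.abs
    rw [abs_zero] at this
    exact this.eventually (gt_mem_nhds (by positivity))
  -- bound on mu
  have hmuB : ∀ᶠ k in atTop, mu k ≤ C0 + K * S k := by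
    filter_upwards [hB, hlam2, hlam3, hw] with k h1 h2 h3 h4
    have e1 : mu k ≤ ∑ i, |b i k| + ∑ i, |l i - lam k| * |c i k| := by
      refine (hmu k).trans ?_
      rw [← Finset.sum_add_distrib]
      refine Finset.sum_le_sum fun i _ => ?_
      rw [← abs_mul]; exact abs_add_le _ _
    rw [hsplit (fun i => |l i - lam k| * |c i k|)] at e1
    have e2 : ∑ i ∈ s, |l i - lam k| * |c i k| ≤ K * X k := by
      rw [hX, Finset.mul_sum]
      refine Finset.sum_le_sum fun i hi => ?_
      gcongr
      have a1 := hlt i (hne i hi)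
      have a2 : t * L ≤ L := by nlinarith
      have := abs_lt.1 a1
      rw [abs_le]; constructor <;> linarith
    have e3 : |l o - lam k| * |c o k| ≤ K * (t ^ k * |c o k|) := by
      rw [← mul_assoc]
      gcongr
      rw [abs_div, abs_of_pos (pow_pos ht0 k), div_lt_iff₀ (pow_pos ht0 k)] at h4
      exact h4.le
    simp only [hSdef]
    linarith
  have hinv : Tendsto (fun k => t * (L * (lam k)⁻¹)) atTop (𝓝 t) := by
    have := ((hlam.inv₀ hL.ne').const_mul L).const_mul t
    rwa [mul_inv_cancel₀ hL.ne', mul_one] at this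
  have hf1 : ∀ᶠ k in atTop, t * (L * (lam k)⁻¹) < (1 + t) / 2 :=
    hinv.eventually (gt_mem_nhds (by linarith))
  have hpow : Tendsto (fun k => t ^ (k+1)) atTop (𝓝 0) :=
    (tendsto_pow_atTop_nhds_zero_of_lt_one ht0.le ht1).comp (tendsto_add_atTop_nat 1)
  have hf2 : ∀ᶠ k in atTop, (2 / L) * K * (D k + t ^ (k+1)) < (1 - t) / 4 := by
    have := (hDlim.add hpow).const_mul ((2 / L) * K)
    simp only [add_zero, mul_zero] at this
    exact this.eventually (gt_mem_nhds (by linarith))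
  have hD1 : ∀ᶠ k in atTop, D k < 1 := hDlim.eventually (gt_mem_nhds one_pos)
  have hSrec : ∀ᶠ k in atTop, S (k+1) ≤ (3 + t) / 4 * S k + (2 / L) * (4 * C0) := by
    filter_upwards [hB, hlam2, hlamt', hmuB, hf1, hf2, hD1] with k h1 h2 h3 h4 h5 h6 h7
    have hlp : 0 < lam k := by linarith
    have hli : (lam k)⁻¹ ≤ 2 / L := by
      rw [inv_le_comm₀ hlp (by positivity), inv_div]; exact h2.le
    have hli0 : 0 ≤ (lam k)⁻¹ := by positivity
    have hmk := hmu0 k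
    have hSk := hS0 k
    have hDk := hD0 k
    have tri : ∀ i, |c i (k+1)| ≤ (lam k)⁻¹ * |l i| * |c i k| + (2 / L) * (|b i k| + mu k * |β i k|) := by
      intro i
      have : |l i * c i k + b i k - mu k * β i k| ≤ |l i| * |c i k| + (|b i k| + mu k * |β i k|) := by
        have a1 := abs_sub (l i * c i k + b i k) (mu k * β i k)
        have a2 := abs_add_le (l i * c i k) (b i k)
        rw [abs_mul, abs_of_nonneg hmk] at a1
        rw [abs_mul] at a2
        linarith
      rw [hc, abs_mul, abs_of_nonneg hli0]
      calc _ ≤ (lam k)⁻¹ * (|l i| * |c i k| + (|b i k| + mu k * |β i k|)) := by gcongr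
        _ ≤ _ := by rw [mul_add, mul_assoc]; gcongr
    have x1 : X (k+1) ≤ t * X k + (2 / L) * (C0 + mu k * D k) := by
      calc X (k+1) ≤ ∑ i ∈ s, (t * |c i k| + (2 / L) * (|b i k| + mu k * |β i k|)) := by
            refine Finset.sum_le_sum fun i hi => (tri i).trans ?_
            gcongr
            rw [inv_mul_le_iff₀ hlp, mul_comm]; exact (h3 i hi).le
        _ = t * X k + (2 / L) * (∑ i ∈ s, |b i k| + mu k * D k) := by
            rw [Finset.sum_add_distrib, ← Finset.mul_sum, ← Finset.mul_sum, Finset.sum_add_distrib,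
              ← Finset.mul_sum]
        _ ≤ _ := by
            gcongr
            exact (Finset.sum_le_univ_sum_of_nonneg (fun _ => abs_nonneg _)).trans h1
    have bo : |b o k| ≤ C0 :=
      (Finset.single_le_sum (f := fun i => |b i k|) (fun _ _ => abs_nonneg _) (Finset.mem_univ o)).trans h1
    have y1 : t ^ (k+1) * |c o (k+1)| ≤ (1 + t) / 2 * (t ^ k * |c o k|) + t ^ (k+1) * ((2 / L) * (C0 + mu k)) := by
      have := tri o
      rw [← hLdef, abs_of_pos hL] at this
      calc _ ≤ t ^ (k+1) * ((lam k)⁻¹ * L * |c o k| + (2 / L) * (C0 + mu k * 1)) := by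
            refine (mul_le_mul_of_nonneg_left this (by positivity)).trans ?_
            gcongr
            exact hβo k
        _ = (t * (L * (lam k)⁻¹)) * (t ^ k * |c o k|) + t ^ (k+1) * ((2 / L) * (C0 + mu k)) := by ring
        _ ≤ _ := by gcongr
    have tp : t ^ (k+1) ≤ 1 := pow_le_one₀ ht0.le ht1.le
    have tp0 : 0 ≤ t ^ (k+1) := by positivity
    have z1 : (2 / L) * (C0 + mu k * D k) ≤ (2 / L) * (2 * C0) + (2 / L) * K * D k * S k := by
      have : mu k * D k ≤ C0 + K * D k * S k := by
        have := mul_le_mul_of_nonneg_right h4 hDk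
        nlinarith
      have h2L : 0 ≤ 2 / L := by positivity
      nlinarith
    have z2 : t ^ (k+1) * ((2 / L) * (C0 + mu k)) ≤ (2 / L) * (2 * C0) + (2 / L) * K * t ^ (k+1) * S k := by
      have h2L : 0 ≤ 2 / L := by positivity
      calc _ ≤ t ^ (k+1) * ((2 / L) * (C0 + (C0 + K * S k))) := by gcongr
        _ = t ^ (k+1) * ((2 / L) * (2 * C0)) + (2 / L) * K * t ^ (k+1) * S k := by ring
        _ ≤ _ := by
          exact add_le_add (mul_le_of_le_one_left (by positivity) tp) le_rfl
    have z3 := mul_le_mul_of_nonneg_right h6.le hSk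
    have z4 : t * X k ≤ (1 + t) / 2 * X k := by
      have := hX0 k
      gcongr; linarith
    have z5 : S k = X k + t ^ k * |c o k| := rfl
    have z6 : S (k+1) = X (k+1) + t ^ (k+1) * |c o (k+1)| := rfl
    nlinarith
  obtain ⟨C, hC, hSb⟩ := pi_bdd S hS0 ((3 + t) / 4) ((2 / L) * (4 * C0)) (by linarith) (by linarith)
    (by positivity) hSrec
  have hmulim : ∀ i, i ≠ o → Tendsto (fun k => mu k * β i k) atTop (𝓝 0) := by
    intro i hi
    have hb2 : ∀ᶠ k in atTop, ‖mu k * β i k‖ ≤ (C0 + K * C) * |β i k| := by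
      filter_upwards [hmuB, hSb] with k h1 h2
      rw [Real.norm_eq_abs, abs_mul, abs_of_nonneg (hmu0 k)]
      gcongr
      exact h1.trans (by gcongr)
    refine squeeze_zero_norm' hb2 ?_
    simpa using (hβ i hi).abs.const_mul (C0 + K * C)
  refine ⟨fun i hi => ?_, ?_⟩
  · have hli : |l i| < L := (hlt i hi).trans_le (by nlinarith)
    have hLi : L - l i ≠ 0 := by have := (abs_lt.1 hli).2; linarith
    have hcl := pi_lim (c i) (fun k => (lam k)⁻¹ * l i) (fun k => (lam k)⁻¹ * (b i k - mu k * β i k))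
      (L⁻¹ * l i) (L⁻¹ * (binf i - 0)) (by
        rw [abs_mul, abs_of_pos (inv_pos.2 hL), inv_mul_lt_iff₀ hL]; linarith)
      ((hlam.inv₀ hL.ne').mul_const _) ((hlam.inv₀ hL.ne').mul ((hb i).sub (hmulim i hi)))
      (fun k => by rw [hc]; ring)
    have := (hb i).add ((hlam.const_sub (l i)).mul hcl)
    convert this using 2
    have h1 : 1 - L⁻¹ * l i ≠ 0 := by
      intro h; apply hLi; field_simp at h; linarith
    field_simp
    ring
  · have hb2 : ∀ᶠ k in atTop, ‖(L - lam k) * c o k‖ ≤ |(L - lam k) / t ^ k| * C := by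
      filter_upwards [hSb] with k h1
      have : t ^ k * |c o k| ≤ C := le_trans (le_add_of_nonneg_left (hX0 k)) h1
      have tk := pow_pos ht0 k
      calc ‖(L - lam k) * c o k‖ = |(L - lam k) / t ^ k| * (t ^ k * |c o k|) := by
            rw [Real.norm_eq_abs, abs_mul, abs_div, abs_of_pos tk]; field_simp
        _ ≤ _ := by gcongr
    refine squeeze_zero_norm' hb2 ?_
    simpa using hlam'.abs.mul_const C

lemma pi_abs {ι E : Type*} [Fintype ι] [DecidableEq ι] [NormedAddCommGroup E]
    [InnerProductSpace ℝ E] [FiniteDimensional ℝ E]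
    (e : OrthonormalBasis ι ℝ E) (T B : E →ₗ[ℝ] E) (o : ι) (l : ι → ℝ)
    (hT : ∀ i x, inner ℝ (e i) (T x) = l i * inner ℝ (e i) x)
    (hL : 0 < l o) (hl : ∀ i, i ≠ o → |l i| < l o)
    (q r : ℕ → E) (lam mu : ℕ → ℝ) (hq0 : ‖q 0‖ = 1) (hqo : inner ℝ (e o) (q 0) ≠ 0)
    (hlam : ∀ k, lam k = ‖T (q k)‖)
    (hq : ∀ k, q (k+1) = (lam k)⁻¹ • T (q k))
    (hmu : ∀ k, mu k = ‖B (q k) + T (r k) - lam k • r k‖)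
    (hr : ∀ k, r (k+1) = (lam k)⁻¹ • (T (r k) + B (q k) - mu k • q k))
    (hd : 0 ≤ inner ℝ (e o) (B (e o))) :
    Tendsto mu atTop (𝓝 (inner ℝ (e o) (B (e o)))) := by
  set L := l o with hLdef
  set β : ι → ℕ → ℝ := fun i k => inner ℝ (e i) (q k) with hβdef
  have hind : ∀ k, ‖q k‖ = 1 ∧ β o k ≠ 0 := by
    intro k
    induction k with
    | zero => exact ⟨hq0, hqo⟩
    | succ k ih =>
      have hne : T (q k) ≠ 0 := by
        intro h
        have := hT o (q k)
        rw [h, inner_zero_right] at this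
        exact mul_ne_zero hL.ne' ih.2 this.symm
      have hn : ‖T (q k)‖ ≠ 0 := norm_ne_zero_iff.2 hne
      constructor
      · rw [hq, hlam, norm_smul, norm_inv, norm_norm, inv_mul_cancel₀ hn]
      · simp only [hβdef]
        rw [hq, hlam, inner_smul_right, hT]
        exact mul_ne_zero (inv_ne_zero hn) (mul_ne_zero hL.ne' ih.2)
  have hβs : ∀ i k, β i (k+1) = (lam k)⁻¹ * (l i * β i k) := by
    intro i k
    simp only [hβdef]
    rw [hq, inner_smul_right, hT]
  have hlampos : ∀ k, 0 < lam k := by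
    intro k
    refine lt_of_le_of_ne (by rw [hlam]; positivity) fun h => ?_
    have := hβs o k
    rw [← h, inv_zero, zero_mul] at this
    exact (hind (k+1)).2 this
  have hsign : ∀ k, 0 < β o k * β o 0 := by
    intro k
    induction k with
    | zero => exact mul_self_pos.2 (hind 0).2
    | succ k ih =>
      rw [hβs, ← hLdef]
      have : (lam k)⁻¹ * (L * β o k) * β o 0 = (lam k)⁻¹ * L * (β o k * β o 0) := by ring
      rw [this]
      have := hlampos k
      positivity
  have hratio : ∀ i k, β i k * β o 0 * L ^ k = l i ^ k * β i 0 * β o k := by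
    intro i k
    induction k with
    | zero => simp [mul_comm]
    | succ k ih =>
      rw [hβs, hβs, ← hLdef, pow_succ, pow_succ]
      linear_combination (lam k)⁻¹ * l i * L * ih
  have hβle : ∀ i k, |β i k| ≤ 1 := by
    intro i k
    have := abs_real_inner_le_norm (e i) (q k)
    rwa [(hind k).1, e.norm_eq_one, one_mul] at this
  -- choose t
  obtain ⟨t, ht0, ht1, hlt⟩ : ∃ t : ℝ, 0 < t ∧ t < 1 ∧ ∀ i, i ≠ o → |l i| < t * L := by
    have h1 : ∀ᶠ t in 𝓝[<] (1:ℝ), 0 < t := nhdsWithin_le_nhds (lt_mem_nhds one_pos)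
    have h2 : ∀ᶠ t in 𝓝[<] (1:ℝ), t < 1 := self_mem_nhdsWithin
    have h3 : ∀ᶠ t in 𝓝[<] (1:ℝ), ∀ i, i ≠ o → |l i| < t * L := by
      rw [eventually_all]
      intro i
      by_cases hi : i = o
      · simp [hi]
      have hc : Tendsto (fun t : ℝ => t * L) (𝓝[<] (1:ℝ)) (𝓝 (1 * L)) :=
        ((continuous_id.mul continuous_const).tendsto' _ _ rfl).mono_left nhdsWithin_le_nhds
      rw [one_mul] at hc
      filter_upwards [hc.eventually (lt_mem_nhds (hl i hi))] with t h _ using h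
    obtain ⟨t, h⟩ := (h1.and (h2.and h3)).exists
    exact ⟨t, h.1, h.2.1, h.2.2⟩
  have hβt : ∀ i, i ≠ o → Tendsto (fun k => β i k / t ^ k) atTop (𝓝 0) := by
    intro i hi
    have hb : ∀ k, ‖β i k / t ^ k‖ ≤ (|l i| / (t * L)) ^ k * (|β i 0| / |β o 0|) := by
      intro k
      have hbo : 0 < |β o 0| := abs_pos.2 (hind 0).2
      have h1 := congrArg abs (hratio i k)
      simp only [abs_mul, abs_pow, abs_of_pos hL] at h1
      rw [Real.norm_eq_abs, abs_div, abs_pow, abs_of_pos ht0, div_pow, mul_pow,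
        div_mul_div_comm, div_le_div_iff₀ (by positivity) (by positivity)]
      calc |β i k| * (t ^ k * L ^ k * |β o 0|) = (|β i k| * |β o 0| * L ^ k) * t ^ k := by ring
        _ = |l i| ^ k * |β i 0| * t ^ k * |β o k| := by rw [h1]; ring
        _ ≤ |l i| ^ k * |β i 0| * t ^ k * 1 := by gcongr; exact hβle o k
        _ = _ := by ring
    refine squeeze_zero_norm hb ?_
    have : Tendsto (fun k => (|l i| / (t * L)) ^ k) atTop (𝓝 0) :=
      tendsto_pow_atTop_nhds_zero_of_lt_one (by positivity)
        (by rw [div_lt_one (by positivity)]; exact hlt i hi)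
    simpa using this.mul_const (|β i 0| / |β o 0|)
  have htk : Tendsto (fun k => t ^ k) atTop (𝓝 0) := tendsto_pow_atTop_nhds_zero_of_lt_one ht0.le ht1
  have hβ0 : ∀ i, i ≠ o → Tendsto (β i) atTop (𝓝 0) := by
    intro i hi
    have := (hβt i hi).mul htk
    rw [zero_mul] at this
    refine this.congr fun k => ?_
    have := pow_pos ht0 k
    field_simp
  have hβsq : ∀ i, i ≠ o → Tendsto (fun k => β i k ^ 2 / t ^ k) atTop (𝓝 0) := by
    intro i hi
    have := (hβt i hi).mul (hβ0 i hi)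
    rw [zero_mul] at this
    refine this.congr fun k => ?_
    ring
  have hsum1 : ∀ k, ∑ i, β i k ^ 2 = 1 := by
    intro k
    have := e.sum_sq_norm_inner_right (q k)
    rw [(hind k).1] at this
    simpa using this
  have hsum2 : ∀ k, ∑ i, (l i * β i k) ^ 2 = lam k ^ 2 := by
    intro k
    have := e.sum_sq_norm_inner_right (T (q k))
    rw [← hlam] at this
    simp only [hT, Real.norm_eq_abs, sq_abs] at this
    exact this
  set s : Finset ι := Finset.univ.erase o with hs
  have hsplit : ∀ f : ι → ℝ, ∑ i, f i = f o + ∑ i ∈ s, f i := fun f =>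
    (Finset.add_sum_erase _ f (Finset.mem_univ o)).symm
  have hne : ∀ i ∈ s, i ≠ o := fun i hi => Finset.ne_of_mem_erase hi
  have hlsq : ∀ i, l i ^ 2 ≤ L ^ 2 := by
    intro i
    by_cases hi : i = o
    · rw [hi]
    · exact sq_le_sq.2 ((hl i hi).le.trans (le_abs_self _))
  have hlamle : ∀ k, lam k ≤ L := by
    intro k
    refine le_of_sq_le_sq ?_ hL.le
    rw [← hsum2]
    calc _ ≤ ∑ i, L ^ 2 * β i k ^ 2 := by
          refine Finset.sum_le_sum fun i _ => ?_
          rw [mul_pow]; exact mul_le_mul_of_nonneg_right (hlsq i) (sq_nonneg _)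
      _ = L ^ 2 := by rw [← Finset.mul_sum, hsum1, mul_one]
  have hlamdiff : ∀ k, L - lam k ≤ L * ∑ i ∈ s, β i k ^ 2 := by
    intro k
    have h1 := hsum1 k
    have h2 := hsum2 k
    rw [hsplit] at h1 h2
    have h3 : 0 ≤ ∑ i ∈ s, (l i * β i k) ^ 2 := Finset.sum_nonneg fun _ _ => sq_nonneg _
    have h4 := hlamle k
    have h5 := hlampos k
    rw [← hLdef, mul_pow] at h2
    have h6 : L * (L - lam k) ≤ L * (L * ∑ i ∈ s, β i k ^ 2) := by nlinarith
    exact le_of_mul_le_mul_left h6 hL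
  have hlam' : Tendsto (fun k => (L - lam k) / t ^ k) atTop (𝓝 0) := by
    refine squeeze_zero (g := fun k => L * ∑ i ∈ s, β i k ^ 2 / t ^ k)
      (fun k => div_nonneg (by linarith [hlamle k]) (by positivity)) (fun k => ?_) ?_
    · rw [← Finset.sum_div, ← mul_div_assoc]
      have := hlamdiff k
      gcongr
    · have : Tendsto (fun k => ∑ i ∈ s, β i k ^ 2 / t ^ k) atTop (𝓝 (∑ i ∈ s, (0:ℝ))) :=
        tendsto_finsetSum _ fun i hi => hβsq i (hne i hi)
      simpa using this.const_mul L
  have hlamlim : Tendsto lam atTop (𝓝 L) := by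
    have h1 := (hlam'.mul htk).const_sub L
    simp only [zero_mul, sub_zero] at h1
    refine h1.congr fun k => ?_
    have := pow_pos ht0 k
    field_simp
    ring
  -- limit of the top coefficient
  set σ : ℝ := β o 0 / |β o 0| with hσ
  have hb0 : 0 < |β o 0| := abs_pos.2 (hind 0).2
  have hσabs : |σ| = 1 := by rw [hσ, abs_div, abs_abs, div_self hb0.ne']
  have hβo : Tendsto (β o) atTop (𝓝 σ) := by
    have h1 : Tendsto (fun k => β o k ^ 2) atTop (𝓝 1) := by
      have : Tendsto (fun k => ∑ i ∈ s, β i k ^ 2) atTop (𝓝 (∑ i ∈ s, (0:ℝ) ^ 2)) :=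
        tendsto_finsetSum _ fun i hi => (hβ0 i (hne i hi)).pow 2
      have h2 := this.const_sub 1
      simp only [ne_eq, OfNat.ofNat_ne_zero, not_false_eq_true, zero_pow, Finset.sum_const_zero,
        sub_zero] at h2
      refine h2.congr fun k => ?_
      have h1 := hsum1 k
      rw [hsplit] at h1
      linarith
    have h2 := (h1.sqrt).const_mul σ
    rw [Real.sqrt_one, mul_one] at h2
    refine h2.congr fun k => ?_
    rw [Real.sqrt_sq_eq_abs, hσ, div_mul_eq_mul_div, div_eq_iff hb0.ne']
    have := hsign k
    rcases lt_or_gt_of_ne (hind 0).2 with h | h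
    · have h' : β o k < 0 := by by_contra h'; push Not at h'; nlinarith
      rw [abs_of_neg h, abs_of_neg h']; ring
    · have h' : 0 < β o k := by by_contra h'; push Not at h'; nlinarith
      rw [abs_of_pos h, abs_of_pos h']; ring
  have hqlim : Tendsto q atTop (𝓝 (σ • e o)) := by
    have : Tendsto (fun k => ∑ i, β i k • e i) atTop (𝓝 (∑ i, (if i = o then σ else 0) • e i)) := by
      refine tendsto_finsetSum _ fun i _ => ?_
      by_cases hi : i = o
      · subst hi; simpa using hβo.smul_const (e i)
      · simpa [hi] using (hβ0 i hi).smul_const (e i)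
    simp only [ite_smul, zero_smul, Finset.sum_ite_eq', Finset.mem_univ, if_true] at this
    refine this.congr fun k => ?_
    exact e.sum_repr' (q k)
  have hBq : Tendsto (fun k => B (q k)) atTop (𝓝 (B (σ • e o))) :=
    (B.continuous_of_finiteDimensional.tendsto _).comp hqlim
  set b : ι → ℕ → ℝ := fun i k => inner ℝ (e i) (B (q k)) with hbdef
  set c : ι → ℕ → ℝ := fun i k => inner ℝ (e i) (r k) with hcdef
  have hb : ∀ i, Tendsto (b i) atTop (𝓝 (inner ℝ (e i) (B (σ • e o)))) := fun i =>
    tendsto_const_nhds.inner hBq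
  set v : ℕ → E := fun k => B (q k) + T (r k) - lam k • r k with hvdef
  have hv : ∀ i k, inner ℝ (e i) (v k) = b i k + (l i - lam k) * c i k := by
    intro i k
    simp only [hvdef, inner_sub_right, inner_add_right, inner_smul_right, hT, hbdef, hcdef]
    ring
  have hvs : ∀ k, v k = ∑ i, (b i k + (l i - lam k) * c i k) • e i := by
    intro k
    rw [← e.sum_repr' (v k)]
    exact Finset.sum_congr rfl fun i _ => by rw [hv]
  have hcore := pi_core o l β c b _ lam mu t ht0 ht1 hL hlt hlamlim hlam' hβ0 (hβle o) hb
    (fun k => by rw [hmu]; positivity)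
    (fun k => by
      rw [hmu]
      change ‖v k‖ ≤ _
      rw [hvs]
      refine (norm_sum_le _ _).trans (le_of_eq ?_)
      refine Finset.sum_congr rfl fun i _ => ?_
      rw [norm_smul, e.norm_eq_one, mul_one, Real.norm_eq_abs])
    (fun i k => by
      simp only [hcdef, hbdef, hβdef]
      rw [hr, inner_smul_right, inner_sub_right, inner_add_right, inner_smul_right, hT])
  have hvlim : Tendsto v atTop (𝓝 (inner ℝ (e o) (B (σ • e o)) • e o)) := by
    have : Tendsto (fun k => ∑ i, (b i k + (l i - lam k) * c i k) • e i) atTop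
        (𝓝 (∑ i, (if i = o then inner ℝ (e o) (B (σ • e o)) else 0) • e i)) := by
      refine tendsto_finsetSum _ fun i _ => ?_
      by_cases hi : i = o
      · subst hi; simpa using ((hb i).add hcore.2).smul_const (e i)
      · simpa [hi] using (hcore.1 i hi).smul_const (e i)
    simp only [ite_smul, zero_smul, Finset.sum_ite_eq', Finset.mem_univ, if_true] at this
    exact this.congr fun k => (hvs k).symm
  have := hvlim.norm
  rw [norm_smul, e.norm_eq_one, mul_one, map_smul, inner_smul_right, norm_mul, Real.norm_eq_abs,
    hσabs, one_mul, Real.norm_eq_abs, abs_of_nonneg hd] at this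
  exact this.congr fun k => (hmu k).symm

lemma pi_hasDeriv {n : ℕ} {f : ℝ → EuclideanSpace ℝ (Fin n)} {f' : EuclideanSpace ℝ (Fin n)} {x : ℝ} :
    HasDerivAt f f' x ↔ ∀ i, HasDerivAt (fun z => f z i) (f' i) x := by
  simp only [hasDerivAt_iff_hasFDerivAt, ← hasFDerivWithinAt_univ]
  rw [hasFDerivWithinAt_euclidean]
  refine forall_congr' fun i => ?_
  have : (PiLp.proj 2 (fun _ : Fin n => ℝ) i : _ →L[ℝ] ℝ) ∘L (ContinuousLinearMap.toSpanSingleton ℝ f') =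
      ContinuousLinearMap.toSpanSingleton ℝ (f' i) := by
    ext; simp
  rw [this]

end PIaux

/-- Theorem 4 (Power Iteration I), derivative-convergence part: for a differentiable
matrix family `z ↦ A(z)` with differentiable orthonormal eigendecomposition near `z₀`,
the modified power iteration run at `z₀` (with `A := A(z₀)` and `A'` the entrywise
derivative at `z₀`) satisfies `μ⁽ᵏ⁾ → λ₁'(z₀)`. -/
theorem power_iteration_derivative_converges (n : ℕ) (hn : 1 ≤ n)
    (A : ℝ → Matrix (Fin n) (Fin n) ℝ) (z₀ : ℝ)
    (hA : ∀ i j, DifferentiableAt ℝ (fun z => A z i j) z₀)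
    (lamb : Fin n → ℝ → ℝ) (e : Fin n → ℝ → EuclideanSpace ℝ (Fin n))
    (hlamb_diff : ∀ i, DifferentiableAt ℝ (lamb i) z₀)
    (he_diff : ∀ i, DifferentiableAt ℝ (e i) z₀)
    (hnbhd : ∀ᶠ z in nhds z₀,
      Orthonormal ℝ (fun i => e i z) ∧
      (∀ i, Matrix.toEuclideanLin (A z) (e i z) = lamb i z • e i z) ∧
      0 < lamb ⟨0, hn⟩ z ∧
      (∀ i, i ≠ ⟨0, hn⟩ → |lamb i z| < lamb ⟨0, hn⟩ z))
    (q0 : ℝ → EuclideanSpace ℝ (Fin n)) (α : Fin n → ℝ → ℝ)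
    (hq0_diff : DifferentiableAt ℝ q0 z₀)
    (hα_diff : ∀ i, DifferentiableAt ℝ (α i) z₀)
    (hrep : ∀ᶠ z in nhds z₀, q0 z = ∑ i, (α i z) • e i z)
    (hq0norm : ‖q0 z₀‖ = 1) (hα1 : α ⟨0, hn⟩ z₀ ≠ 0)
    -- the iteration at z₀
    (q r : ℕ → EuclideanSpace ℝ (Fin n)) (lam mu : ℕ → ℝ)
    (hq_zero : q 0 = q0 z₀) (hr_zero : r 0 = deriv q0 z₀)
    (hlam : ∀ k, lam (k + 1) = ‖Matrix.toEuclideanLin (A z₀) (q k)‖)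
    (hq : ∀ k, q (k + 1) = (lam (k + 1))⁻¹ • Matrix.toEuclideanLin (A z₀) (q k))
    (hmu : ∀ k, mu (k + 1) =
      ‖Matrix.toEuclideanLin (Matrix.of fun i j => deriv (fun z => A z i j) z₀) (q k) +
        Matrix.toEuclideanLin (A z₀) (r k) - lam (k + 1) • r k‖)
    (hr : ∀ k, r (k + 1) = (lam (k + 1))⁻¹ •
      (Matrix.toEuclideanLin (A z₀) (r k) +
        Matrix.toEuclideanLin (Matrix.of fun i j => deriv (fun z => A z i j) z₀) (q k) -
        mu (k + 1) • q k))
    (hderiv_nonneg : 0 ≤ deriv (lamb ⟨0, hn⟩) z₀) :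
    Filter.Tendsto mu Filter.atTop (nhds (deriv (lamb ⟨0, hn⟩) z₀)) := by
  have h0 := hnbhd.self_of_nhds
  obtain ⟨hon, heig, hpos, hgap⟩ := h0
  set o : Fin n := ⟨0, hn⟩ with ho
  have : Nonempty (Fin n) := ⟨o⟩
  let bb := basisOfOrthonormalOfCardEqFinrank hon (by simp)
  have hbb : ⇑bb = fun i => e i z₀ := coe_basisOfOrthonormalOfCardEqFinrank hon (by simp)
  let ob : OrthonormalBasis (Fin n) ℝ (EuclideanSpace ℝ (Fin n)) :=
    bb.toOrthonormalBasis (by rw [hbb]; exact hon)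
  have hob : ∀ i, ob i = e i z₀ := by
    intro i
    simp [ob, hbb]
  have hT : ∀ i x, inner ℝ (ob i) (Matrix.toEuclideanLin (A z₀) x) = lamb i z₀ * inner ℝ (ob i) x := by
    intro i x
    conv_lhs => rw [← ob.sum_repr' x]
    simp only [map_sum, map_smul, inner_sum, inner_smul_right]
    rw [Finset.sum_eq_single i]
    · rw [hob, heig, ← hob, inner_smul_right, real_inner_self_eq_norm_sq, ob.norm_eq_one]; ring
    · intro j _ hj
      rw [hob j, heig, ← hob, inner_smul_right, ob.inner_eq_zero (Ne.symm hj)]; ring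
    · simp
  set B := Matrix.toEuclideanLin (Matrix.of fun i j => deriv (fun z => A z i j) z₀) with hB
  have hd : inner ℝ (ob o) (B (ob o)) = deriv (lamb o) z₀ := by
    have hAe : HasDerivAt (fun z => Matrix.toEuclideanLin (A z) (e o z))
        (B (e o z₀) + Matrix.toEuclideanLin (A z₀) (deriv (e o) z₀)) z₀ := by
      rw [pi_hasDeriv]
      intro i
      have hcoord : ∀ j, HasDerivAt (fun z => e o z j) (deriv (e o) z₀ j) z₀ :=
        pi_hasDeriv.1 (he_diff o).hasDerivAt
      have : HasDerivAt (fun z => ∑ j, A z i j * e o z j)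
          (∑ j, (deriv (fun z => A z i j) z₀ * e o z₀ j + A z₀ i j * deriv (e o) z₀ j)) z₀ :=
        HasDerivAt.fun_sum fun j _ => (hA i j).hasDerivAt.mul (hcoord j)
      rw [Finset.sum_add_distrib] at this
      simpa [hB, Matrix.toLpLin_apply, Matrix.mulVec, dotProduct] using this
    have h1 : HasDerivAt (fun z => inner ℝ (ob o) (Matrix.toEuclideanLin (A z) (e o z)))
        (inner ℝ (ob o) (B (e o z₀) + Matrix.toEuclideanLin (A z₀) (deriv (e o) z₀))) z₀ := by
      simpa using (hasDerivAt_const z₀ (ob o)).inner ℝ hAe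
    have h2' : HasDerivAt (fun z => inner ℝ (ob o) (e o z)) (inner ℝ (ob o) (deriv (e o) z₀)) z₀ := by
      simpa using (hasDerivAt_const z₀ (ob o)).inner ℝ (he_diff o).hasDerivAt
    have h2 := (hlamb_diff o).hasDerivAt.mul h2'
    have heq : (fun z => inner ℝ (ob o) (Matrix.toEuclideanLin (A z) (e o z))) =ᶠ[nhds z₀]
        (lamb o * fun z => inner ℝ (ob o) (e o z)) := by
      filter_upwards [hnbhd] with z hz
      rw [hz.2.1 o, inner_smul_right]; rfl
    have h3 := h1.unique (h2.congr_of_eventuallyEq heq)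
    rw [inner_add_right, hT, ← hob, real_inner_self_eq_norm_sq, ob.norm_eq_one] at h3
    linarith
  have hq1 : inner ℝ (ob o) (q 0) = α o z₀ := by
    rw [hq_zero, hrep.self_of_nhds]
    simp only [← hob]
    simp [inner_sum, inner_smul_right, ob.inner_eq_ite]
  have key := pi_abs ob (Matrix.toEuclideanLin (A z₀)) B o (fun i => lamb i z₀) hT hpos hgap q r
    (fun k => lam (k+1)) (fun k => mu (k+1)) (by rw [hq_zero]; exact hq0norm)
    (by rw [hq1]; exact hα1) hlam hq hmu hr (by rw [hd]; exact hderiv_nonneg)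
  rw [hd] at key
  exact (Filter.tendsto_add_atTop_iff_nat 1).1 key
end
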